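/- The quotient of A*B by the two-sided ideal generated by the single commutator [p₁,q₁] has finite-dimensional irreducible representations of arbitrarily large dimension: for every natural number n there exists a simple left module over this quotient whose k-dimension is finite and greater than n. -/

import Mathlib

open scoped TensorProduct

/-- A two-element family of types, used to form binary free products. -/
def fam (A B : Type) : Bool → Type
  | true => A
  | false => B

instance famSemiring (A B : Type) [Semiring A] [Semiring B] : ∀ b, Semiring (fam A B b)
  | true => ‹Semiring A›
  | false => ‹Semiring B›

instance famAlgebra (k A B : Type) [CommSemiring k] [Semiring A] [Semiring B]
    [Algebra k A] [Algebra k B] : ∀ b, Algebra k (fam A B b)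
  | true => ‹Algebra k A›
  | false => ‹Algebra k B›

/-- The free product (coproduct in the category of unital associative `k`-algebras)
`A * B` of two `k`-algebras. -/
abbrev FP (k A B : Type) [CommSemiring k] [Semiring A] [Semiring B]
    [Algebra k A] [Algebra k B] : Type :=
  LinearAlgebra.FreeProduct k (fam A B)

/-- The canonical map `A →ₐ[k] A * B`. -/
noncomputable def inl (k A B : Type) [CommSemiring k] [Semiring A] [Semiring B]
    [Algebra k A] [Algebra k B] : A →ₐ[k] FP k A B :=
  LinearAlgebra.FreeProduct.ι k (fam A B) true

/-- The canonical map `B →ₐ[k] A * B`. -/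
noncomputable def inr (k A B : Type) [CommSemiring k] [Semiring A] [Semiring B]
    [Algebra k A] [Algebra k B] : B →ₐ[k] FP k A B :=
  LinearAlgebra.FreeProduct.ι k (fam A B) false

/-- The image in `A*B` of the `i`-th standard primitive idempotent of `A = k^⊕3`. -/
noncomputable def pgen (k : Type) [Field k] (i : Fin 3) : FP k (Fin 3 → k) (Fin 3 → k) :=
  inl k (Fin 3 → k) (Fin 3 → k) (Pi.single i 1)

/-- The image in `A*B` of the `i`-th standard primitive idempotent of `B = k^⊕3`. -/
noncomputable def qgen (k : Type) [Field k] (i : Fin 3) : FP k (Fin 3 → k) (Fin 3 → k) :=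
  inr k (Fin 3 → k) (Fin 3 → k) (Pi.single i 1)

/-- The quotient of `k^⊕3 * k^⊕3` by the two-sided ideal generated by `[p₁,q₁]`. -/
abbrev Q10 (k : Type) [Field k] : Type :=
  RingQuot (fun u v : FP k (Fin 3 → k) (Fin 3 → k) =>
    u = pgen k 0 * qgen k 0 - qgen k 0 * pgen k 0 ∧ v = 0)

/-- The algebra map out of `k^⊕3` determined by a complete family of orthogonal idempotents. -/
noncomputable def idempotentsHom {k R ι : Type*} [Field k] [Ring R] [Algebra k R] [Fintype ι]
    (e : ι → R) (he : CompleteOrthogonalIdempotents e) : (ι → k) →ₐ[k] R :=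
  AlgHom.ofLinearMap (Fintype.linearCombination k e)
    (by simp [Fintype.linearCombination_apply, he.complete])
    (by
      classical
      intro x y
      simp [Fintype.linearCombination_apply, Finset.sum_mul, Finset.mul_sum, he.mul_eq, smul_smul,
        mul_comm])

theorem idempotentsHom_single {k R ι : Type*} [Field k] [Ring R] [Algebra k R] [Fintype ι]
    [DecidableEq ι] (e : ι → R) (he : CompleteOrthogonalIdempotents e) (i : ι) :
    idempotentsHom (k := k) e he (Pi.single i 1) = e i := by
  simp [idempotentsHom]

/-- The algebra map out of a free product determined by a pair of algebra maps. -/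
noncomputable def FP.desc {k A B R : Type} [Field k] [Ring A] [Ring B] [Ring R] [Algebra k A]
    [Algebra k B] [Algebra k R] (f : A →ₐ[k] R) (g : B →ₐ[k] R) : FP k A B →ₐ[k] R :=
  LinearAlgebra.FreeProduct.lift k (fam A B) (fun {b} => match b with
    | true => f
    | false => g)

theorem FP.desc_inl {k A B R : Type} [Field k] [Ring A] [Ring B] [Ring R] [Algebra k A]
    [Algebra k B] [Algebra k R] (f : A →ₐ[k] R) (g : B →ₐ[k] R) (a : A) :
    FP.desc f g (inl k A B a) = f a :=
  AlgHom.congr_fun (LinearAlgebra.FreeProduct.lift_comp_ι (i := true) k (fam A B) _) a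

theorem FP.desc_inr {k A B R : Type} [Field k] [Ring A] [Ring B] [Ring R] [Algebra k A]
    [Algebra k B] [Algebra k R] (f : A →ₐ[k] R) (g : B →ₐ[k] R) (b : B) :
    FP.desc f g (inr k A B b) = g b :=
  AlgHom.congr_fun (LinearAlgebra.FreeProduct.lift_comp_ι (i := false) k (fam A B) _) b

/-- Two complete families of orthogonal idempotents whose first members commute define a
representation of `Q10 k`. -/
theorem exists_Q10_hom {k R : Type} [Field k] [Ring R] [Algebra k R] (p q : Fin 3 → R)
    (hp : CompleteOrthogonalIdempotents p) (hq : CompleteOrthogonalIdempotents q)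
    (hpq : Commute (p 0) (q 0)) :
    ∃ φ : Q10 k →ₐ[k] R, (∀ i, p i ∈ φ.range) ∧ ∀ i, q i ∈ φ.range := by
  let ψ := FP.desc (idempotentsHom (k := k) p hp) (idempotentsHom q hq)
  have hψp (i : Fin 3) : ψ (pgen k i) = p i := by
    rw [pgen, FP.desc_inl, idempotentsHom_single]
  have hψq (i : Fin 3) : ψ (qgen k i) = q i := by
    rw [qgen, FP.desc_inr, idempotentsHom_single]
  refine ⟨RingQuot.liftAlgHom k ⟨ψ, ?_⟩, fun i => ⟨RingQuot.mkAlgHom k _ (pgen k i), ?_⟩,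
    fun i => ⟨RingQuot.mkAlgHom k _ (qgen k i), ?_⟩⟩
  · rintro _ _ ⟨rfl, rfl⟩
    simp [hψp, hψq, hpq.eq]
  · simp [hψp]
  · simp [hψq]

/-- A submodule of `k^n` stable under multiplication by a vector with distinct entries is stable
under multiplication by every vector. -/
theorem mul_mem_of_injective {k ι : Type*} [Field k] [Fintype ι] {c : ι → k}
    (hc : Function.Injective c) {S : Submodule k (ι → k)} (hS : ∀ w ∈ S, c * w ∈ S)
    (d : ι → k) {w : ι → k} (hw : w ∈ S) : d * w ∈ S := by
  classical
  have key (f : Polynomial k) : (fun i => f.eval (c i)) * w ∈ S := by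
    induction f using Polynomial.induction_on' with
    | add f g hf hg =>
      convert S.add_mem hf hg using 1
      ext i
      simp [add_mul]
    | monomial m a =>
      have hm : c ^ m * w ∈ S := by
        induction m with
        | zero => simpa
        | succ m ih => simpa [pow_succ', mul_assoc] using hS _ ih
      convert S.smul_mem a hm using 1
      ext i
      simp [mul_assoc]
  convert key (Lagrange.interpolate Finset.univ c d) using 2
  ext i
  exact (Lagrange.eval_interpolate_at_node d hc.injOn (Finset.mem_univ i)).symm

section Model

variable {k ι : Type} [Field k]

/-- The idempotent `(w, x) ↦ (c w + x, (c - c²) w + (1 - c) x)` of `k^n ⊕ k^n`. -/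
def dilation (c : ι → k) : Module.End k ((ι → k) × (ι → k)) where
  toFun v := (c * v.1 + v.2, (c - c * c) * v.1 + (1 - c) * v.2)
  map_add' u v := by ext <;> simp <;> ring
  map_smul' r v := by ext <;> simp

/-- The projection of `k^n ⊕ k^n` onto the constant vectors of the first summand. -/
def average (k ι : Type) [Field k] [Fintype ι] : Module.End k ((ι → k) × (ι → k)) where
  toFun v := (fun _ => (Fintype.card ι : k)⁻¹ * ∑ i, v.1 i, 0)
  map_add' u v := by ext <;> simp [Finset.sum_add_distrib, mul_add]
  map_smul' r v := by ext <;> simp [← Finset.mul_sum, mul_left_comm]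

/-- The projection of `k^n ⊕ k^n` onto the second summand. -/
def projSnd (k ι : Type) [Field k] : Module.End k ((ι → k) × (ι → k)) where
  toFun v := (0, v.2)
  map_add' u v := by ext <;> simp
  map_smul' r v := by ext <;> simp

theorem dilation_mul_self (c : ι → k) : dilation c * dilation c = dilation c := by
  refine LinearMap.ext fun v => ?_
  ext i <;> simp [dilation] <;> ring

theorem completeOrthogonalIdempotents_dilation (c : ι → k) :
    CompleteOrthogonalIdempotents ![0, dilation c, 1 - dilation c] := by
  have h := dilation_mul_self c
  refine ⟨⟨fun i => ?_, fun i j hij => ?_⟩, ?_⟩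
  · fin_cases i <;> simp [IsIdempotentElem, h, mul_sub, sub_mul]
  · fin_cases i <;> fin_cases j <;> simp_all [mul_sub, sub_mul]
  · simp [Fin.sum_univ_three]

theorem completeOrthogonalIdempotents_average [Fintype ι] (hι : (Fintype.card ι : k) ≠ 0) :
    CompleteOrthogonalIdempotents
      ![projSnd k ι, average k ι, 1 - projSnd k ι - average k ι] := by
  have h₁ : projSnd k ι * projSnd k ι = projSnd k ι := rfl
  have h₂ : average k ι * average k ι = average k ι := by
    refine LinearMap.ext fun v => ?_
    ext i <;> simp [average, hι]
  have h₃ : projSnd k ι * average k ι = 0 := by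
    refine LinearMap.ext fun v => ?_
    ext i <;> simp [average, projSnd]
  have h₄ : average k ι * projSnd k ι = 0 := by
    refine LinearMap.ext fun v => ?_
    ext i <;> simp [average, projSnd]
  refine ⟨⟨fun i => ?_, fun i j hij => ?_⟩, ?_⟩
  · fin_cases i <;> simp [IsIdempotentElem, h₁, h₂, h₃, h₄, mul_sub, sub_mul]
  · fin_cases i <;> fin_cases j <;> simp_all [mul_sub, sub_mul]
  · simp [Fin.sum_univ_three]

theorem eq_bot_or_eq_top_of_invariant [Fintype ι] (hι : (Fintype.card ι : k) ≠ 0) {c : ι → k}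
    (hc : Function.Injective c) (hc' : ∀ i, c i - c i * c i ≠ 0)
    {S : Submodule k ((ι → k) × (ι → k))} (hd : ∀ v ∈ S, dilation c v ∈ S)
    (ha : ∀ v ∈ S, average k ι v ∈ S) (hp : ∀ v ∈ S, projSnd k ι v ∈ S) :
    S = ⊥ ∨ S = ⊤ := by
  classical
  have snd_mem {v} (hv : v ∈ S) : ((0, v.2) : (ι → k) × (ι → k)) ∈ S := hp v hv
  have fst_mem {v} (hv : v ∈ S) : ((v.1, 0) : (ι → k) × (ι → k)) ∈ S := by
    convert S.sub_mem hv (snd_mem hv) using 1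
    ext <;> simp
  let W : Submodule k (ι → k) := S.comap (LinearMap.inl k (ι → k) (ι → k))
  have hW : ∀ w ∈ W, c * w ∈ W := fun w hw => by
    simpa [dilation, W] using fst_mem (hd _ hw)
  refine or_iff_not_imp_left.mpr fun hS => ?_
  obtain ⟨w, hw, hw0⟩ : ∃ w ∈ W, w ≠ 0 := by
    obtain ⟨v, hv, hv0⟩ := S.ne_bot_iff.mp hS
    by_cases h : v.1 = 0
    · refine ⟨v.2, ?_, fun h' => hv0 (Prod.ext h h')⟩
      simpa [dilation, W] using fst_mem (hd _ (snd_mem hv))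
    · exact ⟨v.1, fst_mem hv, h⟩
  obtain ⟨i, hi⟩ := Function.ne_iff.mp hw0
  have hone : (1 : ι → k) ∈ W := by
    have h : ((Fintype.card ι : k) • average k ι) (Pi.single i (w i)⁻¹ * w, 0) ∈ S :=
      S.smul_mem _ (ha _ (mul_mem_of_injective hc hW (Pi.single i (w i)⁻¹) hw))
    have hsum : ∑ j, (Pi.single i (w i)⁻¹ * w : ι → k) j = 1 := by
      rw [Finset.sum_eq_single i] <;> simp_all
    have heq : ((1, 0) : (ι → k) × (ι → k)) =
        ((Fintype.card ι : k) • average k ι) (Pi.single i (w i)⁻¹ * w, 0) := by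
      ext j
      · simpa [average, hι] using hsum.symm
      · simp [average]
    simpa [W, heq] using h
  have htop (u : ι → k) : (u, 0) ∈ S := by
    simpa [W] using mul_mem_of_injective hc hW u hone
  have htop' (u : ι → k) : (0, u) ∈ S := by
    have h := snd_mem (hd _ (htop ((c - c * c)⁻¹ * u)))
    convert h using 1
    ext j <;> simp [dilation, mul_inv_cancel_left₀ (hc' j)]
  refine eq_top_iff.mpr fun v _ => ?_
  simpa using S.add_mem (htop v.1) (htop' v.2)

end Model

theorem statement10 (k : Type) [Field k] [IsAlgClosed k] [CharZero k] :
    ∀ n : ℕ, ∃ (M : Type) (_ : AddCommGroup M) (_ : Module (Q10 k) M) (_ : Module k M)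
      (_ : IsScalarTower k (Q10 k) M),
      IsSimpleModule (Q10 k) M ∧ Module.Finite k M ∧ n < Module.finrank k M := by
  intro n
  let ι := Fin (n + 1)
  let c : ι → k := fun i => (i : ℕ) + 2
  have hc : Function.Injective c := fun i j h => by
    simpa [c, Fin.val_inj] using h
  have hc' (i : ι) : c i - c i * c i ≠ 0 := by
    have : c i - c i * c i = -(((i : ℕ) + 2) * ((i : ℕ) + 1) : ℕ) := by
      simp only [c]
      push_cast
      ring
    rw [this, neg_ne_zero, Nat.cast_ne_zero]
    positivity
  have hι : (Fintype.card ι : k) ≠ 0 := by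
    rw [Nat.cast_ne_zero]
    simp [ι]
  obtain ⟨φ, hp, hq⟩ := exists_Q10_hom (k := k) _ _ (completeOrthogonalIdempotents_dilation c)
    (completeOrthogonalIdempotents_average hι) (Commute.zero_left _)
  let inst : Module (Q10 k) ((ι → k) × (ι → k)) := Module.compHom _ φ.toRingHom
  have smul_def (a : Q10 k) (v : (ι → k) × (ι → k)) : a • v = φ a v := rfl
  have tower : IsScalarTower k (Q10 k) ((ι → k) × (ι → k)) :=
    ⟨fun r a v => by simp [smul_def]⟩
  refine ⟨(ι → k) × (ι → k), inferInstance, inst, inferInstance, tower, ?_, inferInstance, ?_⟩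
  · rw [isSimpleModule_iff]
    refine { eq_bot_or_eq_top := fun S => ?_ }
    have hS {f : Module.End k ((ι → k) × (ι → k))} (hf : f ∈ φ.range) :
        ∀ v ∈ S.restrictScalars k, f v ∈ S.restrictScalars k := by
      obtain ⟨a, rfl⟩ := hf
      exact fun v hv => S.smul_mem a hv
    simpa using eq_bot_or_eq_top_of_invariant hι hc hc' (hS (hp 1)) (hS (hq 1)) (hS (hq 0))
  · simp [ι]
    omega
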